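/- arXiv:0812.4567 — 2 statements merged into one kernel-verified Lean document; each statement's English description precedes it below -/
import Mathlib

section
/- Let T_n = (t_{i+j})_{i,j=0}^n be a positive semidefinite Hankel block matrix with Hermitian blocks t_k ∈ ℂ^{l×l} and t_0 > 0 (positive definite). Let D_n be the block lower-triangular Toeplitz matrix with blocks t_0 on the diagonal, t_1 below, …, t_{n−1} in the bottom-left corner, let S = (t_{i+j})_{i,j=1}^n, and let 𝒯_n = (t_1; …; t_n) be the block column. Then the matrix T̂_{n−1} = D_n^{−1} (S − 𝒯_n t_0^{−1} 𝒯_n*) D_n^{−*} is again a Hankel block matrix, i.e. T̂_{n−1} = (t̂_{i+j})_{i,j=0}^{n−1} for some matrices t̂_0, …, t̂_{2n−2} ∈ ℂ^{l×l}. -/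
open Matrix ComplexOrder

/-- The block lower-triangular Toeplitz matrix `D_n` with `(i,j)` block `t_{i−j}` for
`j ≤ i` and `0` otherwise (block index `Fin n`). -/
def lowToeplitz (l n : ℕ) (t : ℕ → Matrix (Fin l) (Fin l) ℂ) :
    Matrix (Fin n × Fin l) (Fin n × Fin l) ℂ :=
  Matrix.of fun p q => if (q.1 : ℕ) ≤ (p.1 : ℕ) then t ((p.1 : ℕ) - (q.1 : ℕ)) p.2 q.2 else 0

/-- The block column `𝒯_n = (t_1; …; t_n)`. -/
def blockCol (l n : ℕ) (t : ℕ → Matrix (Fin l) (Fin l) ℂ) :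
    Matrix (Fin n × Fin l) (Fin l) ℂ :=
  Matrix.of fun p b => t ((p.1 : ℕ) + 1) p.2 b

/-- The Hankel block matrix `S = (t_{i+j})_{i,j=1}^n`. -/
def hankelS (l n : ℕ) (t : ℕ → Matrix (Fin l) (Fin l) ℂ) :
    Matrix (Fin n × Fin l) (Fin n × Fin l) ℂ :=
  Matrix.of fun p q => t ((p.1 : ℕ) + (q.1 : ℕ) + 2) p.2 q.2

section ConvolutionInverse

variable {R : Type*} [Ring R]

/-- A sequence with invertible leading term has a two-sided convolution inverse. -/
theorem exists_convolution_inverse (t : ℕ → R) (h : IsUnit (t 0)) :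
    ∃ c : ℕ → R,
      (∀ k, ∑ a ∈ Finset.range (k + 1), c (k - a) * t a = if k = 0 then 1 else 0) ∧
      ∀ k, ∑ a ∈ Finset.range (k + 1), t a * c (k - a) = if k = 0 then 1 else 0 := by
  obtain ⟨u, hu⟩ := h
  have hc : PowerSeries.constantCoeff (PowerSeries.mk t) = u := by
    rw [← PowerSeries.coeff_zero_eq_constantCoeff_apply, PowerSeries.coeff_mk, hu]
  refine ⟨fun k => PowerSeries.coeff k (PowerSeries.invOfUnit (PowerSeries.mk t) u),
    fun k => ?_, fun k => ?_⟩
  · have key := congrArg (PowerSeries.coeff k) (PowerSeries.invOfUnit_mul _ u hc)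
    rw [PowerSeries.coeff_mul, PowerSeries.coeff_one, ← Finset.Nat.sum_antidiagonal_swap,
      Finset.Nat.sum_antidiagonal_eq_sum_range_succ_mk] at key
    simpa only [Prod.fst_swap, Prod.snd_swap, PowerSeries.coeff_mk] using key
  · have key := congrArg (PowerSeries.coeff k) (PowerSeries.mul_invOfUnit _ u hc)
    rw [PowerSeries.coeff_mul, PowerSeries.coeff_one,
      Finset.Nat.sum_antidiagonal_eq_sum_range_succ_mk] at key
    simpa only [PowerSeries.coeff_mk] using key

/-- The `(i, j)` entry of the Schur complement of the Hankel array of `t`, multiplied on the left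
and on the right by the triangular Toeplitz arrays of `c`. -/
def schurEntry (t c : ℕ → R) (s : R) (i j : ℕ) : R :=
  ∑ a ∈ Finset.range (i + 1), ∑ b ∈ Finset.range (j + 1),
    c (i - a) * (t (a + b + 2) - t (a + 1) * s * t (b + 1)) * c (j - b)

variable {t c : ℕ → R} {s : R}

theorem sum_mul_shift
    (hL : ∀ k, ∑ a ∈ Finset.range (k + 1), c (k - a) * t a = if k = 0 then 1 else 0) (i : ℕ) :
    ∑ a ∈ Finset.range (i + 1), c (i - a) * t (a + 1) = -(c (i + 1) * t 0) := by
  have h := hL (i + 1)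
  rw [Finset.sum_range_succ'] at h
  simp only [Nat.add_sub_add_right, Nat.sub_zero, Nat.add_eq_zero_iff, one_ne_zero, and_false,
    if_false] at h
  exact eq_neg_of_add_eq_zero_left h

theorem sum_shift_mul
    (hR : ∀ k, ∑ a ∈ Finset.range (k + 1), t a * c (k - a) = if k = 0 then 1 else 0) (j : ℕ) :
    ∑ b ∈ Finset.range (j + 1), t (b + 1) * c (j - b) = -(t 0 * c (j + 1)) := by
  have h := hR (j + 1)
  rw [Finset.sum_range_succ'] at h
  simp only [Nat.add_sub_add_right, Nat.sub_zero, Nat.add_eq_zero_iff, one_ne_zero, and_false,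
    if_false] at h
  exact eq_neg_of_add_eq_zero_left h

theorem sum_mul_shift_two
    (hL : ∀ k, ∑ a ∈ Finset.range (k + 1), c (k - a) * t a = if k = 0 then 1 else 0) (i : ℕ) :
    ∑ a ∈ Finset.range (i + 1), c (i - a) * t (a + 2) =
      -(c (i + 2) * t 0) - c (i + 1) * t 1 := by
  have h := sum_mul_shift hL (i + 1)
  rw [Finset.sum_range_succ'] at h
  simp only [Nat.add_sub_add_right, Nat.sub_zero] at h
  exact eq_sub_of_add_eq h

theorem sum_shift_two_mul
    (hR : ∀ k, ∑ a ∈ Finset.range (k + 1), t a * c (k - a) = if k = 0 then 1 else 0) (j : ℕ) :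
    ∑ b ∈ Finset.range (j + 1), t (b + 2) * c (j - b) =
      -(t 0 * c (j + 2)) - t 1 * c (j + 1) := by
  have h := sum_shift_mul hR (j + 1)
  rw [Finset.sum_range_succ'] at h
  simp only [Nat.add_sub_add_right, Nat.sub_zero] at h
  exact eq_sub_of_add_eq h

theorem schurEntry_eq
    (hL : ∀ k, ∑ a ∈ Finset.range (k + 1), c (k - a) * t a = if k = 0 then 1 else 0)
    (hR : ∀ k, ∑ a ∈ Finset.range (k + 1), t a * c (k - a) = if k = 0 then 1 else 0)
    (hs : t 0 * s = 1) (i j : ℕ) :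
    schurEntry t c s i j =
      ∑ a ∈ Finset.range (i + 1), ∑ b ∈ Finset.range (j + 1),
        c (i - a) * t (a + b + 2) * c (j - b) - c (i + 1) * t 0 * c (j + 1) := by
  have h : ∑ a ∈ Finset.range (i + 1), ∑ b ∈ Finset.range (j + 1),
      c (i - a) * (t (a + 1) * s * t (b + 1)) * c (j - b) = c (i + 1) * t 0 * c (j + 1) := by
    calc _ = (∑ a ∈ Finset.range (i + 1), c (i - a) * t (a + 1)) * s *
          ∑ b ∈ Finset.range (j + 1), t (b + 1) * c (j - b) := by
          rw [Finset.sum_mul, Finset.sum_mul_sum]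
          simp only [mul_assoc]
      _ = c (i + 1) * (t 0 * s) * (t 0 * c (j + 1)) := by
          rw [sum_mul_shift hL, sum_shift_mul hR]
          noncomm_ring
      _ = _ := by rw [hs, mul_one, mul_assoc]
  rw [← h]
  simp only [schurEntry, mul_sub, sub_mul, Finset.sum_sub_distrib]

theorem schurEntry_succ_left
    (hL : ∀ k, ∑ a ∈ Finset.range (k + 1), c (k - a) * t a = if k = 0 then 1 else 0)
    (hR : ∀ k, ∑ a ∈ Finset.range (k + 1), t a * c (k - a) = if k = 0 then 1 else 0)
    (hs : t 0 * s = 1) (i j : ℕ) :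
    schurEntry t c s (i + 1) j = schurEntry t c s i (j + 1) := by
  have hl : ∑ b ∈ Finset.range (j + 1), c (i + 1) * t (b + 2) * c (j - b) =
      c (i + 1) * (-(t 0 * c (j + 2)) - t 1 * c (j + 1)) := by
    simp only [← sum_shift_two_mul hR, Finset.mul_sum, mul_assoc]
  have hr : ∑ a ∈ Finset.range (i + 1), c (i - a) * t (a + 2) * c (j + 1) =
      (-(c (i + 2) * t 0) - c (i + 1) * t 1) * c (j + 1) := by
    rw [← sum_mul_shift_two hL, Finset.sum_mul]
  rw [schurEntry_eq hL hR hs, schurEntry_eq hL hR hs, Finset.sum_range_succ']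
  simp only [Finset.sum_range_succ' _ (j + 1), Finset.sum_add_distrib, Nat.add_sub_add_right,
    Nat.sub_zero, Nat.zero_add, Nat.add_zero, hl, hr]
  have hmid : ∀ a b, a + 1 + b + 2 = a + (b + 1) + 2 := fun a b => by omega
  simp only [hmid]
  noncomm_ring

theorem schurEntry_eq_schurEntry_add
    (hL : ∀ k, ∑ a ∈ Finset.range (k + 1), c (k - a) * t a = if k = 0 then 1 else 0)
    (hR : ∀ k, ∑ a ∈ Finset.range (k + 1), t a * c (k - a) = if k = 0 then 1 else 0)
    (hs : t 0 * s = 1) (i j : ℕ) :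
    schurEntry t c s i j = schurEntry t c s 0 (i + j) := by
  induction i generalizing j with
  | zero => rw [Nat.zero_add]
  | succ i ih => rw [schurEntry_succ_left hL hR hs, ih, Nat.add_right_comm, Nat.add_assoc]

end ConvolutionInverse

section BlockMatrix

variable {m R : Type*}

/-- The `n × n` block matrix whose `(i, j)` block is `f i j`. -/
def blockMatrix (n : ℕ) (f : ℕ → ℕ → Matrix m m R) : Matrix (Fin n × m) (Fin n × m) R :=
  Matrix.of fun p q => f p.1 q.1 p.2 q.2

theorem blockMatrix_congr {n : ℕ} {f g : ℕ → ℕ → Matrix m m R}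
    (h : ∀ i < n, ∀ j < n, f i j = g i j) : blockMatrix n f = blockMatrix n g := by
  ext p q
  simp only [blockMatrix, Matrix.of_apply, h _ p.1.isLt _ q.1.isLt]

variable [Ring R]

theorem blockMatrix_mul [Fintype m] (n : ℕ) (f g : ℕ → ℕ → Matrix m m R) :
    blockMatrix n f * blockMatrix n g =
      blockMatrix n fun i j => ∑ k ∈ Finset.range n, f i k * g k j := by
  ext p q
  simp only [blockMatrix, Matrix.mul_apply, Matrix.of_apply, Fintype.sum_prod_type,
    Matrix.sum_apply]
  exact Fin.sum_univ_eq_sum_range (fun k => ∑ x, f p.1 k p.2 x * g k q.1 x q.2) n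

theorem blockMatrix_one [DecidableEq m] (n : ℕ) :
    blockMatrix n (fun i j => if i = j then (1 : Matrix m m R) else 0) = 1 := by
  ext ⟨i, a⟩ ⟨j, b⟩
  by_cases h : i = j
  · simp [blockMatrix, Matrix.one_apply, h]
  · simp [blockMatrix, h, Fin.val_inj]

end BlockMatrix

theorem sum_range_ite_between {M : Type*} [AddCommMonoid M] {n i j : ℕ} (hi : i < n) (hji : j ≤ i)
    (f : ℕ → M) :
    (∑ k ∈ Finset.range n, if j ≤ k ∧ k ≤ i then f (k - j) else 0) =
      ∑ a ∈ Finset.range (i - j + 1), f a := by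
  have hfilter : (Finset.range n).filter (fun k => j ≤ k ∧ k ≤ i) = Finset.Ico j (i + 1) := by
    ext k
    simp only [Finset.mem_filter, Finset.mem_range, Finset.mem_Ico]
    omega
  rw [← Finset.sum_filter, hfilter, Finset.sum_Ico_eq_sum_range, Nat.sub_add_comm hji]
  simp only [Nat.add_sub_cancel_left]

theorem sum_range_ite_le {M : Type*} [AddCommMonoid M] {n i : ℕ} (hi : i < n) (f : ℕ → M) :
    (∑ k ∈ Finset.range n, if k ≤ i then f k else 0) = ∑ a ∈ Finset.range (i + 1), f a := by
  simpa using sum_range_ite_between hi (Nat.zero_le i) f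

section Toeplitz

variable {m R : Type*} [Fintype m] [DecidableEq m] [Ring R] {t c : ℕ → Matrix m m R}

theorem lowerToeplitz_mul_eq_one (n : ℕ)
    (hL : ∀ k, ∑ a ∈ Finset.range (k + 1), c (k - a) * t a = if k = 0 then 1 else 0) :
    blockMatrix n (fun i j => if j ≤ i then c (i - j) else 0) *
      blockMatrix n (fun i j => if j ≤ i then t (i - j) else 0) = 1 := by
  rw [blockMatrix_mul, ← blockMatrix_one]
  refine blockMatrix_congr fun i hi j _ => ?_
  have hterm : ∀ k, ((if k ≤ i then c (i - k) else 0) * if j ≤ k then t (k - j) else 0) =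
      if j ≤ k ∧ k ≤ i then c (i - j - (k - j)) * t (k - j) else 0 := by
    intro k
    by_cases h : j ≤ k ∧ k ≤ i
    · rw [if_pos h.1, if_pos h.2, if_pos h, show i - j - (k - j) = i - k by omega]
    · rw [if_neg h]
      rcases not_and_or.mp h with h | h <;> simp [h]
  simp only [hterm]
  by_cases hji : j ≤ i
  · rw [sum_range_ite_between hi hji fun a => c (i - j - a) * t a, hL]
    exact if_congr (by omega) rfl rfl
  · rw [if_neg (by omega)]
    exact Finset.sum_eq_zero fun k _ => if_neg (by omega)

theorem upperToeplitz_mul_eq_one (n : ℕ)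
    (hR : ∀ k, ∑ a ∈ Finset.range (k + 1), t a * c (k - a) = if k = 0 then 1 else 0) :
    blockMatrix n (fun i j => if i ≤ j then t (j - i) else 0) *
      blockMatrix n (fun i j => if i ≤ j then c (j - i) else 0) = 1 := by
  rw [blockMatrix_mul, ← blockMatrix_one]
  refine blockMatrix_congr fun i _ j hj => ?_
  have hterm : ∀ k, ((if i ≤ k then t (k - i) else 0) * if k ≤ j then c (j - k) else 0) =
      if i ≤ k ∧ k ≤ j then t (k - i) * c (j - i - (k - i)) else 0 := by
    intro k
    by_cases h : i ≤ k ∧ k ≤ j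
    · rw [if_pos h.1, if_pos h.2, if_pos h, show j - i - (k - i) = j - k by omega]
    · rw [if_neg h]
      rcases not_and_or.mp h with h | h <;> simp [h]
  simp only [hterm]
  by_cases hij : i ≤ j
  · rw [sum_range_ite_between hj hij fun a => t a * c (j - i - a), hR]
    exact if_congr (by omega) rfl rfl
  · rw [if_neg (by omega)]
    exact Finset.sum_eq_zero fun k _ => if_neg (by omega)

theorem toeplitz_mul_schur_mul_toeplitz (n : ℕ) (s : Matrix m m R) :
    blockMatrix n (fun i j => if j ≤ i then c (i - j) else 0) *
        blockMatrix n (fun a b => t (a + b + 2) - t (a + 1) * s * t (b + 1)) *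
        blockMatrix n (fun i j => if i ≤ j then c (j - i) else 0) =
      blockMatrix n (schurEntry t c s) := by
  rw [blockMatrix_mul, blockMatrix_mul]
  refine blockMatrix_congr fun i hi j hj => ?_
  simp only [ite_mul, zero_mul, mul_ite, mul_zero]
  rw [sum_range_ite_le hj, schurEntry, Finset.sum_comm]
  refine Finset.sum_congr rfl fun b _ => ?_
  rw [sum_range_ite_le hi, Finset.sum_mul]

end Toeplitz

theorem lowToeplitz_eq_blockMatrix (l n : ℕ) (t : ℕ → Matrix (Fin l) (Fin l) ℂ) :
    lowToeplitz l n t = blockMatrix n fun i j => if j ≤ i then t (i - j) else 0 := by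
  ext p q
  simp only [lowToeplitz, blockMatrix, Matrix.of_apply]
  split_ifs <;> rfl

theorem conjTranspose_lowToeplitz (l n : ℕ) {t : ℕ → Matrix (Fin l) (Fin l) ℂ}
    (ht : ∀ k, (t k).IsHermitian) :
    (lowToeplitz l n t)ᴴ = blockMatrix n fun i j => if i ≤ j then t (j - i) else 0 := by
  ext p q
  simp only [lowToeplitz, blockMatrix, Matrix.conjTranspose_apply, Matrix.of_apply]
  split_ifs
  · exact (ht _).apply _ _
  · exact star_zero _

theorem hankelS_sub_eq_blockMatrix (l n : ℕ) {t : ℕ → Matrix (Fin l) (Fin l) ℂ}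
    (ht : ∀ k, (t k).IsHermitian) (s : Matrix (Fin l) (Fin l) ℂ) :
    hankelS l n t - blockCol l n t * s * (blockCol l n t)ᴴ =
      blockMatrix n fun a b => t (a + b + 2) - t (a + 1) * s * t (b + 1) := by
  ext p q
  simp only [hankelS, blockCol, blockMatrix, Matrix.sub_apply, Matrix.of_apply, Matrix.mul_apply,
    Matrix.conjTranspose_apply, (ht _).apply]

/-- If `T_n = (t_{i+j})_{i,j=0}^n ≥ 0` is a Hankel block matrix with Hermitian blocks and
`t_0 > 0`, then `T̂_{n−1} = D_n⁻¹ (S − 𝒯_n t_0⁻¹ 𝒯_n*) D_n⁻*` is again a Hankel block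
matrix `(t̂_{i+j})_{i,j=0}^{n−1}`. -/
theorem schurComplement_hankel (l n : ℕ)
    (t : ℕ → Matrix (Fin l) (Fin l) ℂ)
    (hherm : ∀ k, (t k).IsHermitian)
    (hT : (Matrix.of fun p q : Fin (n + 1) × Fin l =>
      t ((p.1 : ℕ) + (q.1 : ℕ)) p.2 q.2).PosSemidef)
    (ht0 : (t 0).PosDef) :
    ∃ th : ℕ → Matrix (Fin l) (Fin l) ℂ,
      (lowToeplitz l n t)⁻¹ *
          (hankelS l n t - blockCol l n t * (t 0)⁻¹ * (blockCol l n t)ᴴ) *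
          ((lowToeplitz l n t)ᴴ)⁻¹ =
        Matrix.of fun p q : Fin n × Fin l => th ((p.1 : ℕ) + (q.1 : ℕ)) p.2 q.2 := by
  obtain ⟨c, hL, hR⟩ := exists_convolution_inverse t ht0.isUnit
  have hs : t 0 * (t 0)⁻¹ = 1 :=
    Matrix.mul_nonsing_inv _ ((Matrix.isUnit_iff_isUnit_det _).mp ht0.isUnit)
  refine ⟨schurEntry t c (t 0)⁻¹ 0, ?_⟩
  rw [conjTranspose_lowToeplitz l n hherm, lowToeplitz_eq_blockMatrix,
    hankelS_sub_eq_blockMatrix l n hherm, Matrix.inv_eq_left_inv (lowerToeplitz_mul_eq_one n hL),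
    Matrix.inv_eq_right_inv (upperToeplitz_mul_eq_one n hR), toeplitz_mul_schur_mul_toeplitz]
  exact blockMatrix_congr fun i _ j _ => schurEntry_eq_schurEntry_add hL hR hs i j
end

section
/- Let J = [[0, iI_m],[−iI_m, 0]] and let R ∈ ℂ^{l×2m} satisfy R J R* = 0 with rank R = ν ≤ min(m, l). Then there exist a J-unitary matrix Ψ ∈ ℂ^{2m×2m} (i.e. Ψ J Ψ* = J) and an invertible matrix T ∈ ℂ^{l×l} such that T R Ψ = [[I_ν, 0],[0, 0]]. -/
open Matrix

/-- The signature matrix `J = [[0, iI_m],[−iI_m, 0]]`. -/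
def Jsig (m : ℕ) : Matrix (Fin m ⊕ Fin m) (Fin m ⊕ Fin m) ℂ :=
  Matrix.fromBlocks 0 (Complex.I • 1) (-(Complex.I) • 1) 0

/-- The `l × m` matrix `[[I_ν, 0],[0, 0]]`. -/
def truncatedOne (l m ν : ℕ) : Matrix (Fin l) (Fin m) ℂ :=
  Matrix.of fun i a => if (i : ℕ) = (a : ℕ) ∧ (i : ℕ) < ν then 1 else 0

open scoped ComplexOrder in
/-- The rows of a matrix of rank `ν` can be transformed invertibly so that the first `ν` become
orthonormal and the others vanish. -/
theorem exists_isUnit_mul_conjTranspose_eq_truncatedOne {n : Type*} [Fintype n] (l ν : ℕ)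
    (R : Matrix (Fin l) n ℂ) (hrank : R.rank = ν) (hν : ν ≤ l) :
    ∃ T : Matrix (Fin l) (Fin l) ℂ, IsUnit T ∧
      (T * R) * (T * R)ᴴ = truncatedOne l l ν := by
  have hM : (R * Rᴴ).PosSemidef := Matrix.posSemidef_self_mul_conjTranspose R
  set lam := hM.isHermitian.eigenvalues
  have hcard : Fintype.card {i : Fin l // (i : ℕ) < ν} = Fintype.card {i // lam i ≠ 0} := by
    rw [← hM.isHermitian.rank_eq_card_non_zero_eigs, Matrix.rank_self_mul_conjTranspose, hrank,
      Fintype.card_subtype, Fin.card_filter_val_lt, min_eq_right hν]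
  let e₀ := Fintype.equivOfCardEq hcard
  let e : Equiv.Perm (Fin l) := e₀.extendSubtype
  have he : ∀ i : Fin l, (i : ℕ) < ν → lam (e i) ≠ 0 := e₀.extendSubtype_mem
  have he' : ∀ i : Fin l, ¬ (i : ℕ) < ν → lam (e i) = 0 := fun i hi =>
    not_not.mp (e₀.extendSubtype_not_mem i hi)
  let U : Matrix (Fin l) (Fin l) ℂ := hM.isHermitian.eigenvectorUnitary
  have hU : Uᴴ * U = 1 := Unitary.coe_star_mul_self hM.isHermitian.eigenvectorUnitary
  have hspec : Uᴴ * (R * Rᴴ) * U = diagonal fun i => (lam i : ℂ) := by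
    have h : R * Rᴴ = U * (diagonal fun i => (lam i : ℂ)) * Uᴴ := hM.isHermitian.spectral_theorem
    calc _ = (Uᴴ * U) * (diagonal fun i => (lam i : ℂ)) * (Uᴴ * U) := by
          rw [h]; simp only [Matrix.mul_assoc]
      _ = _ := by rw [hU]; simp
  let c : Fin l → ℝ := fun i => if (i : ℕ) < ν then (√(lam (e i)))⁻¹ else 1
  have hc : ∀ i, (c i : ℂ) ≠ 0 := by
    intro i
    rw [Complex.ofReal_ne_zero]
    by_cases hi : (i : ℕ) < ν
    · have := (hM.eigenvalues_nonneg (e i)).lt_of_ne' (he i hi)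
      simp only [c, hi, if_true]
      exact inv_ne_zero (Real.sqrt_ne_zero'.mpr this)
    · simp [c, hi]
  let C : Matrix (Fin l) (Fin l) ℂ := diagonal fun i => (c i : ℂ)
  have hC : Cᴴ = C := by
    simp only [C, diagonal_conjTranspose]
    congr 1; ext i; simp
  refine ⟨C * (Uᴴ).submatrix e id, ?_, ?_⟩
  · refine IsUnit.mul ?_ ?_
    · rw [Matrix.isUnit_diagonal, Pi.isUnit_iff]
      exact fun i => (hc i).isUnit
    · refine IsUnit.of_mul_eq_one (U.submatrix id e) ?_
      rw [← submatrix_mul _ _ _ _ _ Function.bijective_id, hU, submatrix_one_equiv]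
  · have h1 : (Uᴴ).submatrix e id * (R * Rᴴ) * U.submatrix id e
        = diagonal fun i => (lam (e i) : ℂ) := by
      have := submatrix_diagonal_equiv (fun i => (lam i : ℂ)) e
      rw [← hspec] at this
      rw [submatrix_mul _ _ _ id _ Function.bijective_id,
        submatrix_mul _ _ _ id _ Function.bijective_id, submatrix_id_id] at this
      exact this
    calc _ = C * ((Uᴴ).submatrix e id * (R * Rᴴ) * U.submatrix id e) * C := by
          simp only [conjTranspose_mul, hC, conjTranspose_submatrix, conjTranspose_conjTranspose,
            Matrix.mul_assoc]
      _ = truncatedOne l l ν := by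
          rw [h1]
          simp only [C, diagonal_mul_diagonal]
          ext i j
          rw [diagonal_apply, truncatedOne, of_apply]
          by_cases hij : i = j
          · subst hij
            by_cases hi : (i : ℕ) < ν
            · have h0 := (hM.eigenvalues_nonneg (e i)).lt_of_ne' (he i hi)
              have h2 : √(lam (e i)) ≠ 0 := Real.sqrt_ne_zero'.mpr h0
              have h3 : c i * lam (e i) * c i = 1 := by
                simp only [c, hi, if_true]
                field_simp
                exact (Real.sq_sqrt h0.le).symm
              simp only [hi, and_self, if_true]
              exact_mod_cast h3
            · simp [hi, he' i hi]
          · simp [hij, Fin.val_inj]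

open scoped ComplexOrder in
/-- A matrix whose first `ν` rows are orthonormal and whose other rows vanish is the truncation
of a unitary matrix. -/
theorem exists_unitary_eq_truncatedOne_mul (l m ν : ℕ) (hm : ν ≤ m) (hl : ν ≤ l)
    (A : Matrix (Fin l) (Fin m) ℂ) (hA : A * Aᴴ = truncatedOne l l ν) :
    ∃ U : Matrix (Fin m) (Fin m) ℂ, U * Uᴴ = 1 ∧ A = truncatedOne l m ν * U := by
  have hAij : ∀ i j, A j ⬝ᵥ star (A i) = if (j : ℕ) = i ∧ (j : ℕ) < ν then 1 else 0 :=
    fun i j => congrFun (congrFun hA j) i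
  let v : Fin m → EuclideanSpace ℂ (Fin m) := fun a =>
    WithLp.toLp 2 (if h : (a : ℕ) < l then A ⟨a, h⟩ else 0)
  have hv : ∀ (a : Fin m) (h : (a : ℕ) < ν), v a = WithLp.toLp 2 (A ⟨a, h.trans_le hl⟩) :=
    fun a h => by simp [v, h.trans_le hl]
  have hon : Orthonormal ℂ (Set.domRestrict {a : Fin m | (a : ℕ) < ν} v) := by
    rw [orthonormal_iff_ite]
    rintro ⟨a, ha⟩ ⟨b, hb⟩
    simp only [Set.domRestrict_apply, hv a ha, hv b hb, EuclideanSpace.inner_toLp_toLp, hAij,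
      Subtype.mk.injEq]
    have hb' : (b : ℕ) < ν := hb
    simp [hb', Fin.ext_iff, eq_comm]
  obtain ⟨b, hb⟩ := hon.exists_orthonormalBasis_extension_of_card_eq (by simp)
  refine ⟨of fun a => (b a).ofLp, ?_, ?_⟩
  · ext i j
    have := orthonormal_iff_ite.mp b.orthonormal j i
    rw [EuclideanSpace.inner_eq_star_dotProduct] at this
    rw [one_apply, ← if_congr (eq_comm : j = i ↔ i = j) rfl rfl]
    exact this
  · ext i j
    rw [mul_apply]
    by_cases hi : (i : ℕ) < ν
    · rw [Finset.sum_eq_single ⟨i, hi.trans_le hm⟩]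
      · simp [truncatedOne, hi, hb ⟨i, hi.trans_le hm⟩ hi, hv ⟨i, hi.trans_le hm⟩ hi]
      · intro a _ ha
        have : (i : ℕ) ≠ a := fun h => ha (Fin.ext h.symm)
        simp [truncatedOne, this]
      · simp
    · have h0 : A i = 0 := by
        rw [← dotProduct_self_star_eq_zero, hAij]
        simp [hi]
      simp [truncatedOne, hi, h0]

/-- Let `R ∈ ℂ^{l×2m}` be `J`-neutral (`R J Rᴴ = 0`) with `rank R = ν ≤ min(m, l)`. Then
there exist a `J`-unitary `Ψ` and an invertible `T` with `T R Ψ = [[I_ν, 0],[0, 0]]`. -/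
theorem J_neutral_normal_form (l m ν : ℕ)
    (R : Matrix (Fin l) (Fin m ⊕ Fin m) ℂ)
    (hneutral : R * Jsig m * Rᴴ = 0)
    (hrank : R.rank = ν) (hν : ν ≤ min m l) :
    ∃ (Ψ : Matrix (Fin m ⊕ Fin m) (Fin m ⊕ Fin m) ℂ) (T : Matrix (Fin l) (Fin l) ℂ),
      Ψ * Jsig m * Ψᴴ = Jsig m ∧ IsUnit T ∧
      T * R * Ψ = Matrix.of fun (i : Fin l) (j : Fin m ⊕ Fin m) =>
        Sum.elim (fun a : Fin m => if (i : ℕ) = (a : ℕ) ∧ (i : ℕ) < ν then 1 else 0)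
          (fun _ => 0) j := by
  have hνm := hν.trans (min_le_left _ _)
  have hνl := hν.trans (min_le_right _ _)
  obtain ⟨T, hT, hTR⟩ := exists_isUnit_mul_conjTranspose_eq_truncatedOne l ν R hrank hνl
  have hneut : (T * R) * Jsig m * (T * R)ᴴ = 0 := by
    calc _ = T * (R * Jsig m * Rᴴ) * Tᴴ := by
          simp only [conjTranspose_mul, Matrix.mul_assoc]
      _ = 0 := by simp [hneutral]
  obtain ⟨X, Y, hXY⟩ : ∃ X Y : Matrix (Fin l) (Fin m) ℂ, T * R = fromCols X Y :=
    ⟨_, _, (fromCols_toCols _).symm⟩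
  rw [hXY, conjTranspose_fromCols_eq_fromRows_conjTranspose, fromCols_mul_fromRows] at hTR
  have hsymm : X * Yᴴ = Y * Xᴴ := by
    rw [hXY, Jsig, conjTranspose_fromCols_eq_fromRows_conjTranspose, fromCols_mul_fromBlocks,
      fromCols_mul_fromRows] at hneut
    have h : Complex.I • (X * Yᴴ - Y * Xᴴ) = 0 := by
      rw [← hneut]
      simp [smul_sub]
      abel
    exact sub_eq_zero.mp ((smul_eq_zero.mp h).resolve_left Complex.I_ne_zero)
  obtain ⟨U, hU, hXU⟩ := exists_unitary_eq_truncatedOne_mul l m ν hνm hνl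
    (X + Complex.I • Y) (by
      rw [← hTR]
      simp only [conjTranspose_add, conjTranspose_smul, Matrix.add_mul, Matrix.mul_add,
        Matrix.smul_mul, Matrix.mul_smul, hsymm, Complex.star_def, Complex.conj_I]
      match_scalars <;> norm_num [Complex.I_sq])
  obtain ⟨V, hV, hXV⟩ := exists_unitary_eq_truncatedOne_mul l m ν hνm hνl
    (X - Complex.I • Y) (by
      rw [← hTR]
      simp only [conjTranspose_sub, conjTranspose_smul, Matrix.sub_mul, Matrix.mul_sub,
        Matrix.smul_mul, Matrix.mul_smul, hsymm, Complex.star_def, Complex.conj_I]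
      match_scalars <;> norm_num [Complex.I_sq])
  let P : Matrix (Fin m) (Fin m) ℂ := (1 / 2 : ℂ) • (U + V)
  let Q : Matrix (Fin m) (Fin m) ℂ := (-Complex.I / 2) • (U - V)
  let Φ : Matrix (Fin m ⊕ Fin m) (Fin m ⊕ Fin m) ℂ := fromBlocks P Q (-Q) P
  have hX : X = truncatedOne l m ν * P := by
    simp only [P, Matrix.mul_smul, Matrix.mul_add, ← hXU, ← hXV]
    module
  have hY : Y = truncatedOne l m ν * Q := by
    simp only [Q, Matrix.mul_smul, Matrix.mul_sub, ← hXU, ← hXV, add_sub_sub_cancel]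
    match_scalars
    linear_combination Complex.I_mul_I
  have hstar : star (1 / 2 : ℂ) = 1 / 2 := by simp
  have hstar' : star (-Complex.I / 2) = Complex.I / 2 := by simp
  have hPQ : P * Pᴴ + Q * Qᴴ = 1 := by
    simp only [P, Q, conjTranspose_smul, conjTranspose_add, conjTranspose_sub, Matrix.smul_mul,
      Matrix.mul_smul, Matrix.add_mul, Matrix.mul_add, Matrix.sub_mul, Matrix.mul_sub, hU, hV,
      hstar, hstar']
    match_scalars <;> ring_nf <;> norm_num [Complex.I_sq]
  have hQP : Q * Pᴴ = P * Qᴴ := by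
    simp only [P, Q, conjTranspose_smul, conjTranspose_add, conjTranspose_sub, Matrix.smul_mul,
      Matrix.mul_smul, Matrix.add_mul, Matrix.mul_add, Matrix.sub_mul, Matrix.mul_sub, hU, hV,
      hstar, hstar']
    module
  have hΦ : Φ * Φᴴ = 1 := by
    simp only [Φ, fromBlocks_conjTranspose, fromBlocks_multiply, conjTranspose_neg,
      Matrix.neg_mul, Matrix.mul_neg, neg_neg]
    rw [hPQ, hQP, add_comm (Q * Qᴴ), hPQ]
    simp
  have hΦ' : Φᴴ * Φ = 1 := mul_eq_one_comm.mp hΦ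
  have hcomm : Jsig m * Φ = Φ * Jsig m := by
    simp [Jsig, Φ, fromBlocks_multiply]
  refine ⟨Φᴴ, T, ?_, hT, ?_⟩
  · rw [conjTranspose_conjTranspose, Matrix.mul_assoc, hcomm, ← Matrix.mul_assoc, hΦ',
      Matrix.one_mul]
  · have h : T * R = fromCols (truncatedOne l m ν) (0 : Matrix (Fin l) (Fin m) ℂ) * Φ := by
      rw [hXY, fromCols_mul_fromBlocks]
      simp [← hX, ← hY]
    rw [h, Matrix.mul_assoc, hΦ, Matrix.mul_one]
    ext i (j | j) <;> simp [truncatedOne]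
end
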